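/- arXiv:2604.14383 — 5 statements merged into one kernel-verified Lean document; each statement's English description precedes it below -/
import Mathlib

section
/- Let n be a positive integer. A rectangular composition of n is a maximal element of the poset Comp_n(□) (ordered by row-merges and column-merges) if and only if it is an (n+2)×(n+2) matrix whose first and last rows and columns are entirely zero and whose internal n×n submatrix is a permutation matrix. Consequently, Comp_n(□) has exactly n! maximal elements. -/
attribute [local instance] Classical.propDecidable

/-- `M` is a rectangular composition of `n`: a rectangular array (list of rows, all of the
same length) with at least 2 rows and at least 2 columns, with nonnegative integer entries
summing to `n`, such that every internal row and every internal column has positive sum. -/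
def IsRectComp (n : ℕ) (M : List (List ℕ)) : Prop :=
  2 ≤ M.length ∧ (∀ r ∈ M, 2 ≤ r.length) ∧ (∀ r ∈ M, r.length = M.headI.length) ∧
  (M.map List.sum).sum = n ∧
  (∀ r ∈ (M.drop 1).dropLast, 0 < r.sum) ∧
  (∀ c ∈ (M.transpose.drop 1).dropLast, 0 < c.sum)

/-- `RowMergeStep a b` : `a` is obtained from `b` by replacing two adjacent rows with their
entrywise sum. -/
def RowMergeStep (a b : List (List ℕ)) : Prop :=
  ∃ (u v : List (List ℕ)) (r s : List ℕ),
    b = u ++ r :: s :: v ∧ a = u ++ (List.zipWith (· + ·) r s) :: v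

/-- `RectStep a b` : `a` is obtained from `b` by a single row-merge or column-merge. -/
def RectStep (a b : List (List ℕ)) : Prop :=
  RowMergeStep a b ∨ RowMergeStep a.transpose b.transpose

/-- `a ≤ b` in the poset of rectangular compositions: `a` is obtained from `b` by a
(possibly empty) sequence of row-merges and column-merges. -/
def RectLe (a b : List (List ℕ)) : Prop := Relation.ReflTransGen RectStep a b

/-- The `(n+2) × (n+2)` matrix obtained by padding the permutation matrix of `π` with a row
of zeros above and below and a column of zeros on each side. -/
noncomputable def padPerm (n : ℕ) (π : Equiv.Perm (Fin n)) : List (List ℕ) :=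
  List.ofFn (fun i : Fin (n + 2) => List.ofFn (fun j : Fin (n + 2) =>
    if ∃ a b : Fin n, (i : ℕ) = (a : ℕ) + 1 ∧ (j : ℕ) = (b : ℕ) + 1 ∧ π a = b then 1 else 0))

/-- Prepend the entries of a row to the corresponding columns, as one step of `List.transpose`. -/
def consRow : List ℕ → List (List ℕ) → List (List ℕ)
  | [], cs => cs
  | a :: r, [] => [a] :: consRow r []
  | a :: r, c :: cs => (a :: c) :: consRow r cs

theorem consRow_nil_right (r : List ℕ) : consRow r [] = r.map fun a => [a] := by
  induction r with
  | nil => rfl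
  | cons a r ih => simp [consRow, ih]

theorem consRow_map {ι : Type*} (l : List ι) (g : ι → ℕ) (h : ι → List ℕ) :
    consRow (l.map g) (l.map h) = l.map fun j => g j :: h j := by
  induction l with
  | nil => rfl
  | cons a r ih => simp [consRow, ih]

theorem length_consRow (r : List ℕ) (cs : List (List ℕ)) :
    (consRow r cs).length = max r.length cs.length := by
  induction r generalizing cs with
  | nil => simp [consRow]
  | cons a r ih => cases cs <;> simp [consRow, ih]

theorem length_headI_consRow (r : List ℕ) (cs : List (List ℕ)) :
    (consRow r cs).headI.length = (if r = [] then 0 else 1) + cs.headI.length := by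
  cases r <;> cases cs <;> (simp [consRow, add_comm]; try rfl)

theorem mapM_pop_append (l : List ℕ) (cs : List (List ℕ)) :
    ((cs.mapM List.transpose.pop : StateM (List ℕ) (List (List ℕ))) l).1 ++
      ((cs.mapM List.transpose.pop : StateM (List ℕ) (List (List ℕ))) l).2.map (fun a => [a]) =
        consRow l cs := by
  induction cs generalizing l with
  | nil => simp [consRow_nil_right, pure, StateT.pure]
  | cons c cs ih =>
    cases l with
    | nil =>
      have := ih []
      simp [consRow, List.mapM_cons, List.transpose.pop, bind, StateT.bind, pure, StateT.pure] at *
      generalize (cs.mapM List.transpose.pop : StateM (List ℕ) (List (List ℕ))) [] = x at *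
      obtain ⟨y, z⟩ := x
      simpa using this
    | cons a l =>
      have := ih l
      simp [consRow, List.mapM_cons, List.transpose.pop, bind, StateT.bind, pure, StateT.pure] at *
      generalize (cs.mapM List.transpose.pop : StateM (List ℕ) (List (List ℕ))) l = x at *
      obtain ⟨y, z⟩ := x
      simpa using this

theorem toList_foldl_push (l : List ℕ) (acc : Array (List ℕ)) :
    (l.foldl (init := acc) fun arr a => arr.push [a]).toList =
      acc.toList ++ l.map fun a => [a] := by
  induction l generalizing acc with
  | nil => simp
  | cons a l ih => simp

theorem toList_transpose_go (l : List ℕ) (acc : Array (List ℕ)) :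
    (List.transpose.go l acc).toList = consRow l acc.toList := by
  have h := congrFun (Array.toList_mapM (m := StateM (List ℕ))
    (f := List.transpose.pop) (xs := acc)) l
  rw [← mapM_pop_append, ← h]
  have hgo : List.transpose.go l acc =
      (acc.mapM (m := StateM (List ℕ)) List.transpose.pop l).2.foldl
        (init := (acc.mapM (m := StateM (List ℕ)) List.transpose.pop l).1)
        fun arr a => arr.push [a] := rfl
  rw [hgo, toList_foldl_push]
  rfl

theorem transpose_cons (r : List ℕ) (M : List (List ℕ)) :
    (r :: M).transpose = consRow r M.transpose := by
  simp [List.transpose, toList_transpose_go]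

theorem transpose_nil : ([] : List (List ℕ)).transpose = [] := rfl

theorem length_transpose (M : List (List ℕ)) :
    M.transpose.length = (M.map List.length).foldr max 0 := by
  induction M with
  | nil => rfl
  | cons r M ih => simp [transpose_cons, length_consRow, ih]

theorem length_headI_transpose (M : List (List ℕ)) :
    M.transpose.headI.length = M.countP (· ≠ []) := by
  induction M with
  | nil => rfl
  | cons r M ih =>
    rw [transpose_cons, length_headI_consRow, ih, List.countP_cons]
    by_cases h : r = [] <;> simp [h, add_comm]

theorem RowMergeStep.length_eq {a b : List (List ℕ)} (h : RowMergeStep a b) :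
    b.length = a.length + 1 := by
  obtain ⟨u, v, r, s, rfl, rfl⟩ := h
  simp; omega

theorem RowMergeStep.length_headI_le {a b : List (List ℕ)} (h : RowMergeStep a b) :
    a.headI.length ≤ b.headI.length := by
  obtain ⟨u, v, r, s, rfl, rfl⟩ := h
  cases u <;> simp

theorem RowMergeStep.foldr_max_le {a b : List (List ℕ)} (h : RowMergeStep a b) :
    (a.map List.length).foldr max 0 ≤ (b.map List.length).foldr max 0 := by
  obtain ⟨u, v, r, s, rfl, rfl⟩ := h
  induction u with
  | nil => simp; omega
  | cons x u ih => simp at ih ⊢; omega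

theorem RowMergeStep.countP_le {a b : List (List ℕ)} (h : RowMergeStep a b) :
    a.countP (· ≠ []) ≤ b.countP (· ≠ []) := by
  obtain ⟨u, v, r, s, rfl, rfl⟩ := h
  simp only [List.countP_append, List.countP_cons]
  cases r <;> cases s <;> simp

theorem RowMergeStep.countP_lt {a b : List (List ℕ)} (h : RowMergeStep a b)
    (ha : ∀ r ∈ a, r ≠ []) : a.countP (· ≠ []) < b.countP (· ≠ []) := by
  obtain ⟨u, v, r, s, rfl, rfl⟩ := h
  have := ha (List.zipWith (· + ·) r s) (by simp)
  simp only [List.countP_append, List.countP_cons]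
  cases r <;> cases s <;> simp at this ⊢

/-- The number of nonempty rows plus the number of columns. -/
noncomputable def semiPerimeter (M : List (List ℕ)) : ℕ :=
  M.countP (· ≠ []) + M.transpose.length

theorem RectStep.semiPerimeter_le {a b : List (List ℕ)} (h : RectStep a b) :
    semiPerimeter a ≤ semiPerimeter b := by
  rcases h with h | h
  · have h1 := h.countP_le
    have h2 := h.foldr_max_le
    rw [← length_transpose, ← length_transpose] at h2
    exact Nat.add_le_add h1 h2
  · have h1 := h.length_eq
    have h2 := h.length_headI_le
    rw [length_headI_transpose, length_headI_transpose] at h2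
    exact Nat.add_le_add h2 (by omega)

theorem RectStep.semiPerimeter_lt {a b : List (List ℕ)} (h : RectStep a b)
    (ha : ∀ r ∈ a, r ≠ []) : semiPerimeter a < semiPerimeter b := by
  rcases h with h | h
  · have h1 := h.countP_lt ha
    have h2 := h.foldr_max_le
    rw [← length_transpose, ← length_transpose] at h2
    exact Nat.add_lt_add_of_lt_of_le h1 h2
  · have h1 := h.length_eq
    have h2 := h.length_headI_le
    rw [length_headI_transpose, length_headI_transpose] at h2
    exact Nat.add_lt_add_of_le_of_lt h2 (by omega)

theorem RectLe.semiPerimeter_le {a b : List (List ℕ)} (h : RectLe a b) :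
    semiPerimeter a ≤ semiPerimeter b := by
  induction h with
  | refl => exact le_rfl
  | tail _ h ih => exact ih.trans h.semiPerimeter_le

theorem RectLe.eq_of_semiPerimeter_le {a b : List (List ℕ)} (h : RectLe a b)
    (ha : ∀ r ∈ a, r ≠ []) (hab : semiPerimeter b ≤ semiPerimeter a) : b = a := by
  rcases Relation.ReflTransGen.cases_head h with h | ⟨c, hc, h⟩
  · exact h.symm
  · have h1 := hc.semiPerimeter_lt ha
    have h2 := RectLe.semiPerimeter_le h
    omega

/-- The `p × q` array with entries `f i j`, as a list of rows. -/
def arrayOf (p q : ℕ) (f : ℕ → ℕ → ℕ) : List (List ℕ) :=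
  (List.range p).map fun i => (List.range q).map (f i)

theorem arrayOf_succ (p q : ℕ) (f : ℕ → ℕ → ℕ) :
    arrayOf (p + 1) q f = (List.range q).map (f 0) :: arrayOf p q fun i => f (i + 1) := by
  simp [arrayOf, List.range_succ_eq_map, Function.comp_def]

theorem transpose_arrayOf {p : ℕ} (hp : 0 < p) (q : ℕ) (f : ℕ → ℕ → ℕ) :
    (arrayOf p q f).transpose = arrayOf q p fun j i => f i j := by
  induction p, hp using Nat.le_induction generalizing f with
  | base =>
    rw [arrayOf_succ, transpose_cons]
    simp [arrayOf, transpose_nil, consRow_nil_right]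
  | succ p hp ih =>
    rw [arrayOf_succ, transpose_cons, ih, arrayOf, consRow_map]
    simp [arrayOf, List.range_succ_eq_map, Function.comp_def]

theorem arrayOf_congr {p q : ℕ} {f g : ℕ → ℕ → ℕ} (h : ∀ i < p, ∀ j < q, f i j = g i j) :
    arrayOf p q f = arrayOf p q g := by
  refine List.map_congr_left fun i hi => List.map_congr_left fun j hj => ?_
  exact h i (List.mem_range.1 hi) j (List.mem_range.1 hj)

theorem semiPerimeter_arrayOf {p q : ℕ} (hp : 0 < p) (hq : 0 < q) (f : ℕ → ℕ → ℕ) :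
    semiPerimeter (arrayOf p q f) = p + q := by
  rw [semiPerimeter, transpose_arrayOf hp]
  congr 1
  · rw [List.countP_eq_length.2]
    · simp [arrayOf]
    · simp [arrayOf]; omega
  · simp [arrayOf]

theorem sum_map_range (q : ℕ) (f : ℕ → ℕ) :
    ((List.range q).map f).sum = ∑ j ∈ Finset.range q, f j := by
  simp [Finset.sum, Multiset.range]

theorem mem_internal_map_range {α : Type*} (p : ℕ) (f : ℕ → α) (x : α) :
    x ∈ (((List.range p).map f).drop 1).dropLast ↔ ∃ i, 0 < i ∧ i + 1 < p ∧ f i = x := by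
  rw [List.mem_iff_getElem]
  simp only [List.getElem_dropLast, List.getElem_drop, List.getElem_map, List.getElem_range,
    List.length_dropLast, List.length_drop, List.length_map, List.length_range]
  constructor
  · rintro ⟨i, hi, h⟩
    exact ⟨1 + i, by omega, by omega, h⟩
  · rintro ⟨i, h0, hi, h⟩
    exact ⟨i - 1, by omega, by rwa [Nat.add_sub_cancel' h0]⟩

/-- The entries `f i j` with `i < p` and `j < q` form a rectangular composition of `n`. -/
def IsRectFun (n p q : ℕ) (f : ℕ → ℕ → ℕ) : Prop :=
  2 ≤ p ∧ 2 ≤ q ∧ ∑ i ∈ Finset.range p, ∑ j ∈ Finset.range q, f i j = n ∧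
  (∀ i, 0 < i → i + 1 < p → 0 < ∑ j ∈ Finset.range q, f i j) ∧
  (∀ j, 0 < j → j + 1 < q → 0 < ∑ i ∈ Finset.range p, f i j)

theorem IsRectFun.swap {n p q : ℕ} {f : ℕ → ℕ → ℕ} (h : IsRectFun n p q f) :
    IsRectFun n q p fun j i => f i j :=
  ⟨h.2.1, h.1, by rw [Finset.sum_comm]; exact h.2.2.1, h.2.2.2.2, h.2.2.2.1⟩

theorem isRectComp_arrayOf {n p q : ℕ} {f : ℕ → ℕ → ℕ} :
    IsRectComp n (arrayOf p q f) ↔ IsRectFun n p q f := by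
  unfold IsRectComp IsRectFun
  have hlen : (arrayOf p q f).length = p := by simp [arrayOf]
  rw [hlen]
  refine and_congr_right fun hp => ?_
  rw [transpose_arrayOf (by omega)]
  have hmem : ∀ r ∈ arrayOf p q f, r.length = q := by simp [arrayOf]
  have hrows : (∀ r ∈ arrayOf p q f, 2 ≤ r.length) ↔ 2 ≤ q := by
    constructor
    · intro h
      have := h ((List.range q).map (f 0))
        (List.mem_map.2 ⟨0, List.mem_range.2 (by omega), rfl⟩)
      simpa using this
    · intro h r hr
      rw [hmem r hr]; exact h
  have hhead : (arrayOf p q f).headI.length = q := by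
    obtain ⟨p, rfl⟩ : ∃ p', p = p' + 1 := ⟨p - 1, by omega⟩
    simp [arrayOf_succ]
  have hsum : ((arrayOf p q f).map List.sum).sum =
      ∑ i ∈ Finset.range p, ∑ j ∈ Finset.range q, f i j := by
    rw [arrayOf, List.map_map, sum_map_range]
    simp [sum_map_range]
  have hpos : ∀ (p q : ℕ) (f : ℕ → ℕ → ℕ), (∀ r ∈ ((arrayOf p q f).drop 1).dropLast, 0 < r.sum) ↔
      ∀ i, 0 < i → i + 1 < p → 0 < ∑ j ∈ Finset.range q, f i j := by
    intro p q f
    unfold arrayOf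
    simp only [mem_internal_map_range]
    constructor
    · intro h i h0 hi
      rw [← sum_map_range]
      exact h _ ⟨i, h0, hi, rfl⟩
    · rintro h r ⟨i, h0, hi, rfl⟩
      rw [sum_map_range]
      exact h i h0 hi
  rw [hrows, hhead, hsum, hpos, hpos]
  exact and_congr_right fun _ => ⟨fun h => h.2, fun h => ⟨hmem, h⟩⟩

theorem IsRectComp.exists_arrayOf {n : ℕ} {M : List (List ℕ)} (h : IsRectComp n M) :
    ∃ p q f, M = arrayOf p q f ∧ IsRectFun n p q f := by
  have hM : M = arrayOf M.length M.headI.length fun i j => (M.getD i []).getD j 0 := by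
    refine List.ext_getElem (by simp [arrayOf]) fun i hi _ => ?_
    have hr := h.2.2.1 M[i] (List.getElem_mem hi)
    refine List.ext_getElem (by simp [arrayOf, hr]) fun j hj _ => ?_
    simp [arrayOf, hi, hj]
  refine ⟨_, _, _, hM, ?_⟩
  rw [← isRectComp_arrayOf, ← hM]
  exact h

theorem IsRectFun.row_le {n p q : ℕ} {f : ℕ → ℕ → ℕ} (h : IsRectFun n p q f) : p ≤ n + 2 := by
  obtain ⟨hp, -, hsum, hrow, -⟩ := h
  obtain ⟨p, rfl⟩ : ∃ p', p = p' + 2 := ⟨p - 2, by omega⟩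
  rw [Finset.sum_range_succ, Finset.sum_range_succ'] at hsum
  have h1 : ∑ _i ∈ Finset.range p, 1 ≤
      ∑ i ∈ Finset.range p, ∑ j ∈ Finset.range q, f (i + 1) j :=
    Finset.sum_le_sum fun i hi => hrow (i + 1) (by omega) (by simp at hi; omega)
  simp at h1
  omega

theorem maximal_of_square {n : ℕ} {f : ℕ → ℕ → ℕ} {b : List (List ℕ)}
    (hb : IsRectComp n b) (hle : RectLe (arrayOf (n + 2) (n + 2) f) b) :
    b = arrayOf (n + 2) (n + 2) f := by
  obtain ⟨p, q, g, rfl, hg⟩ := hb.exists_arrayOf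
  refine hle.eq_of_semiPerimeter_le (by simp [arrayOf]) ?_
  have hp : 0 < p := zero_lt_two.trans_le hg.1
  have hq : 0 < q := zero_lt_two.trans_le hg.2.1
  rw [semiPerimeter_arrayOf hp hq,
    semiPerimeter_arrayOf (Nat.succ_pos _) (Nat.succ_pos _)]
  have h1 := hg.row_le
  have h2 := hg.swap.row_le
  omega

theorem rowMergeStep_arrayOf {p q k : ℕ} {f g : ℕ → ℕ → ℕ} (hk : k < p)
    (hlt : ∀ i < k, g i = f i) (heq : ∀ j < q, g k j + g (k + 1) j = f k j)
    (hgt : ∀ i, k < i → g (i + 1) = f i) :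
    RowMergeStep (arrayOf p q f) (arrayOf (p + 1) q g) := by
  obtain ⟨m, rfl⟩ : ∃ m, p = k + (m + 1) := ⟨p - k - 1, by omega⟩
  refine ⟨(List.range k).map fun i => (List.range q).map (f i),
    (List.range m).map fun i => (List.range q).map (f (k + (i + 1))),
    (List.range q).map (g k), (List.range q).map (g (k + 1)), ?_, ?_⟩
  · rw [arrayOf, show k + (m + 1) + 1 = k + (m + 2) by omega, List.range_add, List.map_append]
    congr 1
    · exact List.map_congr_left fun i hi => by rw [hlt i (List.mem_range.1 hi)]
    · rw [List.range_succ_eq_map, List.range_succ_eq_map]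
      simp only [List.map_cons, List.map_map, Function.comp_def, add_zero]
      refine congrArg _ (congrArg _ (List.map_congr_left fun i _ => ?_))
      rw [← hgt (k + (i + 1)) (by omega)]
      rfl
  · rw [arrayOf, List.range_add, List.map_append, List.range_succ_eq_map]
    simp only [List.map_cons, List.map_map, Function.comp_def, add_zero,
      List.zipWith_map, List.zipWith_self]
    refine congrArg _ (congrArg₂ _ (List.map_congr_left fun j hj => ?_) rfl)
    exact (heq j (List.mem_range.1 hj)).symm

theorem sum_range_merge {p k : ℕ} {a b : ℕ → ℕ} (hk : k < p)
    (hlt : ∀ i < k, b i = a i) (heq : b k + b (k + 1) = a k)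
    (hgt : ∀ i, k < i → b (i + 1) = a i) :
    ∑ i ∈ Finset.range (p + 1), b i = ∑ i ∈ Finset.range p, a i := by
  induction p, hk using Nat.le_induction with
  | base =>
    rw [Finset.sum_range_succ, Finset.sum_range_succ, Finset.sum_range_succ, add_assoc, heq]
    rw [Finset.sum_congr rfl fun i hi => hlt i (Finset.mem_range.1 hi)]
  | succ p hp ih => rw [Finset.sum_range_succ, ih, hgt p hp, ← Finset.sum_range_succ]

/-- No row of the array of entries `f i j` can be split into two. -/
def RowMaximal (n p q : ℕ) (f : ℕ → ℕ → ℕ) : Prop :=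
  ∀ g, IsRectFun n (p + 1) q g → ¬ RowMergeStep (arrayOf p q f) (arrayOf (p + 1) q g)

theorem RowMaximal.not_split {n p q k : ℕ} {f : ℕ → ℕ → ℕ} (hmax : RowMaximal n p q f)
    (hf : IsRectFun n p q f) (hk : k < p) (r s : ℕ → ℕ) (hrs : ∀ j < q, r j + s j = f k j)
    (hr : 0 < k → 0 < ∑ j ∈ Finset.range q, r j)
    (hs : k + 1 < p → 0 < ∑ j ∈ Finset.range q, s j) : False := by
  obtain ⟨g, hlt, hgr, hgs, hgt⟩ : ∃ g : ℕ → ℕ → ℕ, (∀ i < k, g i = f i) ∧ g k = r ∧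
      g (k + 1) = s ∧ ∀ i, k < i → g (i + 1) = f i := by
    refine ⟨fun i => if i < k then f i else if i = k then r else if i = k + 1 then s
      else f (i - 1), ?_, ?_, ?_, ?_⟩
    · intro i hi; simp [hi]
    · simp
    · simp
    · intro i hi
      simp [show ¬ i + 1 < k by omega, show i + 1 ≠ k by omega, show i ≠ k by omega]
  have hrow : ∑ j ∈ Finset.range q, g k j + ∑ j ∈ Finset.range q, g (k + 1) j =
      ∑ j ∈ Finset.range q, f k j := by
    rw [← Finset.sum_add_distrib, hgr, hgs]
    exact Finset.sum_congr rfl fun j hj => hrs j (Finset.mem_range.1 hj)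
  refine hmax g ⟨by have := hf.1; omega, hf.2.1, ?_, ?_, ?_⟩
    (rowMergeStep_arrayOf hk hlt (by simpa only [hgr, hgs] using hrs) hgt)
  · rw [← hf.2.2.1]
    exact sum_range_merge hk (fun i hi => by rw [hlt i hi]) hrow (fun i hi => by rw [hgt i hi])
  · intro i h0 hi
    rcases lt_trichotomy i k with h | rfl | h
    · rw [hlt i h]; exact hf.2.2.2.1 i h0 (by omega)
    · rw [hgr]; exact hr h0
    · obtain ⟨i, rfl⟩ : ∃ i', i = i' + 1 := ⟨i - 1, by omega⟩
      rcases (show k ≤ i by omega).eq_or_lt with rfl | h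
      · rw [hgs]; exact hs (by omega)
      · rw [hgt i h]; exact hf.2.2.2.1 i (by omega) (by omega)
  · intro j h0 hj
    rw [sum_range_merge hk (fun i hi => by rw [hlt i hi])
      (by rw [hgr, hgs]; exact hrs j (by omega)) (fun i hi => by rw [hgt i hi])]
    exact hf.2.2.2.2 j h0 hj

theorem RowMaximal.sum_first {n p q : ℕ} {f : ℕ → ℕ → ℕ} (hmax : RowMaximal n p q f)
    (hf : IsRectFun n p q f) : ∑ j ∈ Finset.range q, f 0 j = 0 := by
  by_contra h
  exact hmax.not_split hf (k := 0) (by have := hf.1; omega) 0 (f 0) (by simp) (by simp)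
    fun _ => Nat.pos_of_ne_zero h

theorem RowMaximal.sum_last {n p q : ℕ} {f : ℕ → ℕ → ℕ} (hmax : RowMaximal n (p + 1) q f)
    (hf : IsRectFun n (p + 1) q f) : ∑ j ∈ Finset.range q, f p j = 0 := by
  by_contra h
  exact hmax.not_split hf (k := p) (by omega) (f p) 0 (by simp)
    (fun _ => Nat.pos_of_ne_zero h) (by simp)

theorem RowMaximal.sum_internal {n p q k : ℕ} {f : ℕ → ℕ → ℕ} (hmax : RowMaximal n p q f)
    (hf : IsRectFun n p q f) (h0 : 0 < k) (hk : k + 1 < p) :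
    ∑ j ∈ Finset.range q, f k j = 1 := by
  have hpos := hf.2.2.2.1 k h0 hk
  by_contra h
  obtain ⟨j, hj, hfj⟩ := Finset.exists_ne_zero_of_sum_ne_zero hpos.ne'
  have hle : ∀ i, (Pi.single j 1 : ℕ → ℕ) i ≤ f k i := by
    intro i
    rcases eq_or_ne i j with rfl | hij
    · simpa using Nat.one_le_iff_ne_zero.2 hfj
    · simp [hij]
  have hone : ∑ i ∈ Finset.range q, (Pi.single j 1 : ℕ → ℕ) i = 1 := by
    rw [Finset.sum_eq_single_of_mem j hj fun i _ hij => by simp [hij]]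
    simp
  have hadd : ∀ i, (Pi.single j 1 : ℕ → ℕ) i + (f k i - (Pi.single j 1 : ℕ → ℕ) i) = f k i :=
    fun i => Nat.add_sub_cancel' (hle i)
  refine hmax.not_split hf (k := k) (by omega) (Pi.single j 1)
    (fun i => f k i - (Pi.single j 1 : ℕ → ℕ) i) (fun i _ => hadd i) (fun _ => ?_) (fun _ => ?_)
  · rw [hone]; exact one_pos
  · have : ∑ i ∈ Finset.range q, f k i = 1 +
        ∑ i ∈ Finset.range q, (f k i - (Pi.single j 1 : ℕ → ℕ) i) := by
      refine .trans ?_ (congrArg (· + _) hone)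
      simp only [← Finset.sum_add_distrib]
      exact Finset.sum_congr rfl fun i _ => (hadd i).symm
    omega

theorem RowMaximal.card_rows {n p q : ℕ} {f : ℕ → ℕ → ℕ} (hmax : RowMaximal n p q f)
    (hf : IsRectFun n p q f) : p = n + 2 := by
  obtain ⟨p, rfl⟩ : ∃ p', p = p' + 2 := ⟨p - 2, by have := hf.1; omega⟩
  have hsum := hf.2.2.1
  rw [Finset.sum_range_succ, Finset.sum_range_succ', hmax.sum_first hf, hmax.sum_last hf,
    Finset.sum_congr rfl fun i hi => hmax.sum_internal hf (k := i + 1) (by omega)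
      (by simp at hi; omega)] at hsum
  simp at hsum
  omega

theorem exists_perm_of_sum_eq_one {ι : Type*} [Fintype ι] {F : ι → ι → ℕ}
    (hrow : ∀ a, ∑ b, F a b = 1) (hcol : ∀ b, ∑ a, F a b = 1) :
    ∃ π : Equiv.Perm ι, ∀ a b, F a b = if π a = b then 1 else 0 := by
  have hex : ∀ a, ∃ b, F a b ≠ 0 := fun a => by
    obtain ⟨b, -, hb⟩ := Finset.exists_ne_zero_of_sum_ne_zero (by rw [hrow a]; exact one_ne_zero)
    exact ⟨b, hb⟩
  have huniq : ∀ G : ι → ℕ, ∑ b, G b = 1 → ∀ b c, G b ≠ 0 → G c ≠ 0 → b = c := by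
    intro G hG b c hb hc
    by_contra hbc
    have := Finset.add_le_sum (s := Finset.univ) (f := G) (fun _ _ => Nat.zero_le _)
      (Finset.mem_univ b) (Finset.mem_univ c) hbc
    omega
  choose σ hσ using hex
  have hinj : Function.Injective σ := fun a a' h =>
    huniq (fun a => F a (σ a')) (hcol _) a a' (by rw [← h]; exact hσ a) (hσ a')
  refine ⟨Equiv.ofBijective σ (Finite.injective_iff_bijective.1 hinj), fun a b => ?_⟩
  rw [Equiv.ofBijective_apply]
  split_ifs with h
  · subst h
    rw [← hrow a, Finset.sum_eq_single_of_mem (σ a) (Finset.mem_univ _)]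
    intro b _ hb
    by_contra h
    exact hb (huniq _ (hrow a) _ _ h (hσ a))
  · by_contra hb
    exact h (huniq _ (hrow a) _ _ (hσ a) hb)

/-- The entries of the padded permutation matrix of `π`. -/
noncomputable def padPermFun (n : ℕ) (π : Equiv.Perm (Fin n)) (i j : ℕ) : ℕ :=
  if ∃ a b : Fin n, i = (a : ℕ) + 1 ∧ j = (b : ℕ) + 1 ∧ π a = b then 1 else 0

theorem padPerm_eq_arrayOf (n : ℕ) (π : Equiv.Perm (Fin n)) :
    padPerm n π = arrayOf (n + 2) (n + 2) (padPermFun n π) := by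
  have h : ∀ (m : ℕ) {α : Type} (g : ℕ → α), List.ofFn (fun i : Fin m => g i) =
      (List.range m).map g := fun m α g => List.ext_getElem (by simp) fun i _ _ => by simp
  unfold padPerm arrayOf
  rw [← h]
  refine congrArg _ (funext fun i => ?_)
  rw [← h]
  rfl

theorem padPermFun_succ_succ (n : ℕ) (π : Equiv.Perm (Fin n)) (a b : Fin n) :
    padPermFun n π (a + 1) (b + 1) = if π a = b then 1 else 0 := by
  unfold padPermFun
  congr 1
  simp [← Fin.ext_iff, eq_comm]

theorem padPermFun_eq_zero (n : ℕ) (π : Equiv.Perm (Fin n)) {i j : ℕ}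
    (h : i = 0 ∨ i = n + 1 ∨ j = 0 ∨ j = n + 1) : padPermFun n π i j = 0 := by
  unfold padPermFun
  refine if_neg ?_
  rintro ⟨a, b, rfl, rfl, -⟩
  omega

theorem padPermFun_symm (n : ℕ) (π : Equiv.Perm (Fin n)) (i j : ℕ) :
    padPermFun n π.symm j i = padPermFun n π i j := by
  unfold padPermFun
  congr 1
  simp only [eq_iff_iff]
  constructor
  · rintro ⟨a, b, rfl, rfl, rfl⟩
    exact ⟨_, _, rfl, rfl, by simp⟩
  · rintro ⟨a, b, rfl, rfl, rfl⟩
    exact ⟨_, _, rfl, rfl, by simp⟩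

theorem sum_range_add_two (n : ℕ) (f : ℕ → ℕ) :
    ∑ i ∈ Finset.range (n + 2), f i = ∑ a : Fin n, f (a + 1) + f 0 + f (n + 1) := by
  rw [Finset.sum_range_succ, Finset.sum_range_succ', Finset.sum_range]

theorem sum_padPermFun_succ (n : ℕ) (π : Equiv.Perm (Fin n)) (a : Fin n) :
    ∑ j ∈ Finset.range (n + 2), padPermFun n π (a + 1) j = 1 := by
  rw [sum_range_add_two]
  simp [padPermFun_succ_succ, padPermFun_eq_zero]

theorem isRectFun_padPermFun (n : ℕ) (π : Equiv.Perm (Fin n)) :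
    IsRectFun n (n + 2) (n + 2) (padPermFun n π) := by
  have hrow : ∀ (π : Equiv.Perm (Fin n)) (i : ℕ), 0 < i → i + 1 < n + 2 →
      0 < ∑ j ∈ Finset.range (n + 2), padPermFun n π i j := by
    intro π i h0 hi
    obtain ⟨i, rfl⟩ : ∃ i', i = i' + 1 := ⟨i - 1, by omega⟩
    rw [sum_padPermFun_succ n π ⟨i, by omega⟩]
    exact one_pos
  refine ⟨by omega, by omega, ?_, hrow π, fun j h0 hj => ?_⟩
  · rw [sum_range_add_two]
    simp [sum_padPermFun_succ, padPermFun_eq_zero]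
  · simp only [← padPermFun_symm n π]
    exact hrow π.symm j h0 hj

theorem padPerm_injective (n : ℕ) : Function.Injective (padPerm n) := by
  intro π σ h
  ext a : 1
  have hentry : padPermFun n π (a + 1) (π a + 1) = padPermFun n σ (a + 1) (π a + 1) := by
    have := congrArg (fun M : List (List ℕ) => (M.getD (a + 1) []).getD (π a + 1) 0) h
    simpa [padPerm_eq_arrayOf, arrayOf] using this
  rw [padPermFun_succ_succ, padPermFun_succ_succ, if_pos rfl] at hentry
  by_contra hne
  simp [Ne.symm hne] at hentry

theorem exists_padPerm_of_maximal {n p q : ℕ} {f : ℕ → ℕ → ℕ} (hf : IsRectFun n p q f)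
    (hrow : RowMaximal n p q f) (hcol : RowMaximal n q p fun j i => f i j) :
    ∃ π : Equiv.Perm (Fin n), arrayOf p q f = padPerm n π := by
  have hf' := hf.swap
  obtain rfl := hrow.card_rows hf
  obtain rfl := hcol.card_rows hf'
  have hr0 := hrow.sum_first hf
  have hr1 := hrow.sum_last hf
  have hc0 := hcol.sum_first hf'
  have hc1 := hcol.sum_last hf'
  simp only [Finset.sum_eq_zero_iff, Finset.mem_range] at hr0 hr1 hc0 hc1
  obtain ⟨π, hπ⟩ := exists_perm_of_sum_eq_one (F := fun a b : Fin n => f (a + 1) (b + 1))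
    (fun a => by
      have := hrow.sum_internal hf (k := a + 1) (by omega) (by omega)
      rw [sum_range_add_two, hc0 _ (by omega), hc1 _ (by omega)] at this
      simpa using this)
    (fun b => by
      have := hcol.sum_internal hf' (k := b + 1) (by omega) (by omega)
      rw [sum_range_add_two, hr0 _ (by omega), hr1 _ (by omega)] at this
      simpa using this)
  refine ⟨π, ?_⟩
  rw [padPerm_eq_arrayOf]
  refine arrayOf_congr fun i hi j hj => ?_
  by_cases h : i = 0 ∨ i = n + 1 ∨ j = 0 ∨ j = n + 1
  · rw [padPermFun_eq_zero n π h]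
    rcases h with rfl | rfl | rfl | rfl
    exacts [hr0 _ hj, hr1 _ hj, hc0 _ hi, hc1 _ hi]
  · obtain ⟨i, rfl⟩ : ∃ i', i = i' + 1 := ⟨i - 1, by omega⟩
    obtain ⟨j, rfl⟩ : ∃ j', j = j' + 1 := ⟨j - 1, by omega⟩
    have hπ' := hπ ⟨i, by omega⟩ ⟨j, by omega⟩
    refine hπ'.trans (.trans ?_ (padPermFun_succ_succ n π ⟨i, by omega⟩ ⟨j, by omega⟩).symm)
    congr

theorem maximal_iff_exists_padPerm {n : ℕ} {M : List (List ℕ)} (hM : IsRectComp n M) :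
    (∀ b : List (List ℕ), IsRectComp n b → RectLe M b → b = M) ↔
      ∃ π : Equiv.Perm (Fin n), M = padPerm n π := by
  constructor
  · intro hmax
    obtain ⟨p, q, f, rfl, hf⟩ := hM.exists_arrayOf
    have hp : 0 < p := zero_lt_two.trans_le hf.1
    have hq : 0 < q := zero_lt_two.trans_le hf.2.1
    have hperim := semiPerimeter_arrayOf hp hq f
    refine exists_padPerm_of_maximal hf (fun g hg hstep => ?_) (fun g hg hstep => ?_)
    · have := hmax _ (isRectComp_arrayOf.2 hg) (.single (.inl hstep))
      rw [← this, semiPerimeter_arrayOf (by omega) hq] at hperim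
      omega
    · have hstep' : RectStep (arrayOf p q f) (arrayOf p (q + 1) fun i j => g j i) := by
        refine .inr ?_
        rw [transpose_arrayOf hp, transpose_arrayOf hp]
        exact hstep
      have := hmax _ (isRectComp_arrayOf.2 hg.swap) (.single hstep')
      rw [← this, semiPerimeter_arrayOf hp (by omega)] at hperim
      omega
  · rintro ⟨π, rfl⟩ b hb hle
    rw [padPerm_eq_arrayOf] at hle ⊢
    exact maximal_of_square hb hle

/-- A rectangular composition of `n` is a maximal element of the poset of rectangular
compositions of `n` if and only if it is a permutation matrix padded with zeros on all four
sides; consequently there are exactly `n!` maximal elements. -/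
theorem rectComp_maximal_iff_padPerm (n : ℕ) (hn : 0 < n) :
    (∀ M : List (List ℕ), IsRectComp n M →
      ((∀ b : List (List ℕ), IsRectComp n b → RectLe M b → b = M) ↔
        ∃ π : Equiv.Perm (Fin n), M = padPerm n π)) ∧
    {M : List (List ℕ) | IsRectComp n M ∧
      ∀ b : List (List ℕ), IsRectComp n b → RectLe M b → b = M}.ncard = n.factorial := by
  refine ⟨fun M hM => maximal_iff_exists_padPerm hM, ?_⟩
  have hset : {M : List (List ℕ) | IsRectComp n M ∧
      ∀ b : List (List ℕ), IsRectComp n b → RectLe M b → b = M} = Set.range (padPerm n) := by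
    ext M
    constructor
    · rintro ⟨hM, hmax⟩
      obtain ⟨π, rfl⟩ := (maximal_iff_exists_padPerm hM).1 hmax
      exact ⟨π, rfl⟩
    · rintro ⟨π, rfl⟩
      have hπ : IsRectComp n (padPerm n π) := by
        rw [padPerm_eq_arrayOf]
        exact isRectComp_arrayOf.2 (isRectFun_padPermFun n π)
      exact ⟨hπ, (maximal_iff_exists_padPerm hπ).2 ⟨π, rfl⟩⟩
  rw [hset, ← Set.image_univ, Set.ncard_image_of_injective _ (padPerm_injective n),
    Set.ncard_univ, Nat.card_eq_fintype_card, Fintype.card_perm, Fintype.card_fin]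
end

section
/- Let n be a positive integer, and for each permutation π of [n] let M̂_π denote the (n+2)×(n+2) matrix obtained by padding the permutation matrix of π with a row of zeros above and below and a column of zeros on each side. For distinct permutations π ≠ π′ of [n], there exists a matrix obtainable from M̂_π by a single row-merge or a single column-merge and also obtainable from M̂_{π′} by a single row-merge or a single column-merge, if and only if π′ is obtained from π by composing with an adjacent transposition σ_i = (i, i+1) on the left or on the right (i.e. π′ = σ_i ∘ π or π′ = π ∘ σ_i for some i ∈ [n−1]). Equivalently, the dual graph of the top-dimensional cells of Mult_n(Q) is the graph obtained by overlaying the left and right Cayley graphs of Sym_n with respect to the adjacent transpositions. -/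
attribute [local instance] Classical.propDecidable

/-- The `m × k` matrix, as a list of rows, with entries `E i j`. -/
def listMatrix (m k : ℕ) (E : ℕ → ℕ → ℕ) : List (List ℕ) :=
  (List.range m).map fun i => (List.range k).map (E i)

/-- Merging rows `i` and `i + 1` of a matrix given by its entries. -/
def mergeRows (i : ℕ) (E : ℕ → ℕ → ℕ) (r c : ℕ) : ℕ :=
  if r < i then E r c else if r = i then E i c + E (i + 1) c else E (r + 1) c

/-- The entries of the padded permutation matrix. -/
noncomputable def padEntry {n : ℕ} (π : Equiv.Perm (Fin n)) (i j : ℕ) : ℕ :=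
  if ∃ a b : Fin n, i = (a : ℕ) + 1 ∧ j = (b : ℕ) + 1 ∧ π a = b then 1 else 0

theorem padPerm_eq_listMatrix {n : ℕ} (π : Equiv.Perm (Fin n)) :
    padPerm n π = listMatrix (n + 2) (n + 2) (padEntry π) := by
  have h (m : ℕ) {α : Type} (f : ℕ → α) :
      List.ofFn (fun i : Fin m => f i) = (List.range m).map f := by
    apply List.ext_getElem <;> simp
  unfold padPerm listMatrix
  rw [← h (n + 2) fun i => (List.range (n + 2)).map (padEntry π i)]
  congr 1
  funext i
  exact h (n + 2) (padEntry π i)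

theorem listMatrix_length (m k : ℕ) (E : ℕ → ℕ → ℕ) : (listMatrix m k E).length = m := by
  simp [listMatrix]

theorem listMatrix_inj {m k : ℕ} {E F : ℕ → ℕ → ℕ} (h : listMatrix m k E = listMatrix m k F)
    {i j : ℕ} (hi : i < m) (hj : j < k) : E i j = F i j := by
  unfold listMatrix at h
  rw [List.map_inj_left] at h
  have h' := h i (List.mem_range.2 hi)
  rw [List.map_inj_left] at h'
  exact h' j (List.mem_range.2 hj)

theorem rowMergeStep_listMatrix_iff {m k : ℕ} {E : ℕ → ℕ → ℕ} {A : List (List ℕ)} :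
    RowMergeStep A (listMatrix (m + 1) k E) ↔
      ∃ i < m, A = listMatrix m k (mergeRows i E) := by
  have key : ∀ i, i < m → ∀ (u v : List (List ℕ)) (r s : List ℕ), u.length = i →
      listMatrix (m + 1) k E = u ++ r :: s :: v →
      u ++ List.zipWith (· + ·) r s :: v = listMatrix m k (mergeRows i E) := by
    intro i hi u v r s hu h
    have hlen := congrArg List.length h
    simp only [listMatrix_length, List.length_append, List.length_cons] at hlen
    have hrow : ∀ j, j < m + 1 →
        (u ++ r :: s :: v)[j]? = some ((List.range k).map (E j)) := by
      intro j hj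
      rw [← h, listMatrix]
      simp [hj]
    have hr : r = (List.range k).map (E i) := by
      have := hrow i (by omega)
      simpa [← hu] using this
    have hs : s = (List.range k).map (E (i + 1)) := by
      have := hrow (i + 1) (by omega)
      rw [List.getElem?_append_right (by omega)] at this
      simpa [hu] using this
    apply List.ext_getElem?
    intro j
    rcases lt_or_ge j m with hj | hj
    · have hR : (listMatrix m k (mergeRows i E))[j]? =
          some ((List.range k).map (mergeRows i E j)) := by
        simp [listMatrix, hj]
      rw [hR]
      rcases lt_trichotomy j i with hji | rfl | hji
      · have := hrow j (by omega)
        rw [List.getElem?_append_left (by omega)] at this ⊢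
        rw [this]
        congr 1
        apply List.map_congr_left
        intro c _
        simp [mergeRows, hji]
      · rw [List.getElem?_append_right (by omega)]
        simp only [hu, Nat.sub_self, List.getElem?_cons_zero, hr, hs]
        congr 1
        rw [List.zipWith_map, List.zipWith_self]
        apply List.map_congr_left
        intro c _
        simp [mergeRows]
      · have := hrow (j + 1) (by omega)
        obtain ⟨d, rfl⟩ : ∃ d, j = i + (d + 1) := ⟨j - i - 1, by omega⟩
        rw [List.getElem?_append_right (by omega)] at this ⊢
        have e1 : i + (d + 1) + 1 - u.length = d + 1 + 1 := by omega
        have e2 : i + (d + 1) - u.length = d + 1 := by omega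
        rw [e1, List.getElem?_cons_succ, List.getElem?_cons_succ] at this
        rw [e2, List.getElem?_cons_succ, this]
        congr 1
        apply List.map_congr_left
        intro c _
        simp [mergeRows]
    · rw [List.getElem?_eq_none, List.getElem?_eq_none]
      · rw [listMatrix_length]; exact hj
      · simp only [List.length_append, List.length_cons]; omega
  constructor
  · rintro ⟨u, v, r, s, h, rfl⟩
    have hlen := congrArg List.length h
    simp only [listMatrix_length, List.length_append, List.length_cons] at hlen
    exact ⟨u.length, by omega, key _ (by omega) u v r s rfl h⟩
  · rintro ⟨i, hi, rfl⟩
    set L := listMatrix (m + 1) k E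
    have hl : L.length = m + 1 := listMatrix_length _ _ _
    have hsplit : L = L.take i ++ L[i] :: L[i + 1] :: L.drop (i + 2) := by
      rw [List.getElem_cons_drop, List.getElem_cons_drop, List.take_append_drop]
    refine ⟨_, _, _, _, hsplit, (key i hi _ _ _ _ ?_ hsplit).symm⟩
    rw [List.length_take]
    omega

theorem mapM_pop_eq {α : Type*} (L : List (List α)) (l : List α) (h : l.length = L.length) :
    (L.mapM List.transpose.pop : StateM (List α) (List (List α))) l =
      (List.zipWith List.cons l L, []) := by
  induction L generalizing l with
  | nil =>
    obtain rfl := List.length_eq_zero_iff.1 h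
    rfl
  | cons x L ih =>
    cases l with
    | nil => simp at h
    | cons a l =>
      have := ih l (by simpa using h)
      rw [List.mapM_cons]
      change (let p := (L.mapM List.transpose.pop : StateM (List α) (List (List α))) l
        ((a :: x) :: p.1, p.2)) = _
      rw [this]
      rfl

theorem transpose_go_empty {α : Type*} (l : List α) :
    List.transpose.go l #[] = (l.map fun a => [a]).toArray := by
  have h : ∀ (l : List α) (acc : Array (List α)),
      l.foldl (fun arr a => arr.push [a]) acc = acc ++ (l.map fun a => [a]).toArray := by
    intro l
    induction l with
    | nil => simp
    | cons a l ih => intro acc; simp [ih]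
  have := h l #[]
  rw [Array.empty_append] at this
  have hm : ((#[] : Array (List α)).mapM List.transpose.pop :
      StateM (List α) (Array (List α))) l = (#[], l) := by
    rw [Array.mapM_eq_mapM_toList]
    rfl
  unfold List.transpose.go
  rw [hm]
  exact this

theorem transpose_go_of_length_eq {α : Type*} (l : List α) (L : List (List α))
    (h : l.length = L.length) :
    List.transpose.go l L.toArray = (List.zipWith List.cons l L).toArray := by
  have hm : (L.toArray.mapM List.transpose.pop : StateM (List α) (Array (List α))) l =
      ((List.zipWith List.cons l L).toArray, []) := by
    rw [Array.mapM_eq_mapM_toList]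
    change (let p := (L.mapM List.transpose.pop : StateM (List α) (List (List α))) l
      (p.1.toArray, p.2)) = _
    rw [mapM_pop_eq L l h]
  unfold List.transpose.go
  rw [hm]
  rfl

theorem transpose_listMatrix {m : ℕ} (hm : 0 < m) (k : ℕ) (E : ℕ → ℕ → ℕ) :
    (listMatrix m k E).transpose = listMatrix k m (fun i j => E j i) := by
  obtain ⟨m, rfl⟩ := Nat.exists_eq_add_one.2 hm
  clear hm
  have h : (listMatrix (m + 1) k E).foldr List.transpose.go #[] =
      (listMatrix k (m + 1) (fun i j => E j i)).toArray := by
    induction m generalizing E with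
    | zero => simp [listMatrix, transpose_go_empty, Function.comp_def]
    | succ m ih =>
      have hcons : listMatrix (m + 1 + 1) k E =
          (List.range k).map (E 0) :: listMatrix (m + 1) k (fun i => E (i + 1)) := by
        unfold listMatrix
        rw [List.range_succ_eq_map, List.map_cons, List.map_map]
        rfl
      rw [hcons, List.foldr_cons, ih, transpose_go_of_length_eq _ _ (by simp [listMatrix])]
      congr 1
      unfold listMatrix
      rw [List.zipWith_map, List.zipWith_self]
      apply List.map_congr_left
      intro i _
      rw [List.range_succ_eq_map (n := m + 1), List.map_cons, List.map_map]
      rfl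
  rw [List.transpose, h]

theorem padEntry_succ {n : ℕ} (π : Equiv.Perm (Fin n)) (a : Fin n) (j : ℕ) :
    padEntry π (a + 1) j = if j = (π a : ℕ) + 1 then 1 else 0 := by
  unfold padEntry
  congr 1
  simp only [eq_iff_iff]
  constructor
  · rintro ⟨a', b, h1, h2, h3⟩
    obtain rfl : a = a' := Fin.ext (by omega)
    rw [h2, h3]
  · intro h
    exact ⟨a, π a, rfl, h, rfl⟩

theorem padEntry_inv {n : ℕ} (π : Equiv.Perm (Fin n)) (i j : ℕ) :
    padEntry π⁻¹ i j = padEntry π j i := by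
  unfold padEntry
  congr 1
  simp only [eq_iff_iff]
  constructor
  · rintro ⟨a, b, h1, h2, h3⟩
    exact ⟨b, a, h2, h1, by rw [← h3]; simp⟩
  · rintro ⟨a, b, h1, h2, h3⟩
    exact ⟨b, a, h2, h1, by rw [← h3]; simp⟩

theorem transpose_padPerm {n : ℕ} (π : Equiv.Perm (Fin n)) :
    (padPerm n π).transpose = padPerm n π⁻¹ := by
  rw [padPerm_eq_listMatrix, padPerm_eq_listMatrix, transpose_listMatrix (by omega)]
  congr 1
  funext i j
  rw [padEntry_inv]

/-- The row to which row `r` is sent when rows `i` and `i + 1` are merged. -/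
def mergedIndex (i r : ℕ) : ℕ := if r ≤ i then r else r - 1

theorem mergeRows_padEntry_ne_zero_iff {n : ℕ} (π : Equiv.Perm (Fin n)) (i r : ℕ) (a : Fin n) :
    mergeRows i (padEntry π) r (π a + 1) ≠ 0 ↔ r = mergedIndex i (a + 1) := by
  have h : ∀ r, padEntry π r (π a + 1) = if r = a + 1 then 1 else 0 := by
    intro r
    rw [← padEntry_inv, padEntry_succ]
    simp
  unfold mergeRows mergedIndex
  simp only [h]
  split_ifs <;> omega

theorem eq_or_eq_swap_of_mergedIndex {n : ℕ} (hn : 0 < n) {i j : ℕ} (hi : i ≤ n) (hj : j ≤ n)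
    (τ : Equiv.Perm (Fin n))
    (h : ∀ a : Fin n, mergedIndex i (a + 1) = mergedIndex j (τ a + 1)) :
    τ = 1 ∨ ∃ (k : ℕ) (hk : k + 1 < n),
      τ = Equiv.swap (⟨k, Nat.lt_of_succ_lt hk⟩ : Fin n) ⟨k + 1, hk⟩ := by
  have hinj : ∀ a b : Fin n, (a : ℕ) ≠ b → (τ a : ℕ) ≠ τ b := by
    intro a b hab heq
    exact hab (congrArg Fin.val (τ.injective (Fin.ext heq)))
  unfold mergedIndex at h
  by_cases hmid : 0 < i ∧ i < n
  · obtain ⟨k, rfl⟩ : ∃ k, i = k + 1 := ⟨i - 1, by omega⟩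
    have hk : k + 1 < n := hmid.2
    set x : Fin n := ⟨k, by omega⟩
    set y : Fin n := ⟨k + 1, hk⟩
    have hxv : (x : ℕ) = k := rfl
    have hyv : (y : ℕ) = k + 1 := rfl
    have hX := h x
    have hY := h y
    have hXY := hinj x y (by omega)
    have hji : j = k + 1 := by
      split_ifs at hX hY <;> omega
    subst hji
    have hfix : ∀ a : Fin n, a ≠ x → a ≠ y → τ a = a := by
      intro a hax hay
      have hax' : (a : ℕ) ≠ k := fun e => hax (Fin.ext e)
      have hay' : (a : ℕ) ≠ k + 1 := fun e => hay (Fin.ext e)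
      have ha := h a
      apply Fin.ext
      split_ifs at ha <;> omega
    by_cases hxx : (τ x : ℕ) = k
    · left
      ext a
      by_cases hax : a = x
      · rw [hax]; exact hxx
      by_cases hay : a = y
      · rw [hay]
        simp only [Equiv.Perm.coe_one, id_eq]
        split_ifs at hX hY <;> omega
      rw [hfix a hax hay]; rfl
    · right
      refine ⟨k, hk, ?_⟩
      ext a
      by_cases hax : a = x
      · rw [hax, Equiv.swap_apply_left]
        split_ifs at hX hY <;> omega
      by_cases hay : a = y
      · rw [hay, Equiv.swap_apply_right]
        split_ifs at hX hY <;> omega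
      rw [hfix a hax hay, Equiv.swap_apply_of_ne_of_ne hax hay]
  · left
    have hij : i = j := by
      rcases Nat.eq_zero_or_pos i with rfl | hpos
      · have h0 := h ⟨0, hn⟩
        simp only at h0
        split_ifs at h0 <;> omega
      · have h0 := h ⟨n - 1, by omega⟩
        have := (τ ⟨n - 1, by omega⟩).isLt
        simp only at h0
        split_ifs at h0 <;> omega
    subst hij
    ext a
    have ha := h a
    have := (τ a).isLt
    have := a.isLt
    simp only [Equiv.Perm.coe_one, id_eq]
    split_ifs at ha <;> omega

theorem eq_or_eq_mul_swap_of_rowMergeStep {n : ℕ} (hn : 0 < n) {π π' : Equiv.Perm (Fin n)}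
    {D : List (List ℕ)} (h : RowMergeStep D (padPerm n π)) (h' : RowMergeStep D (padPerm n π')) :
    π' = π ∨ ∃ (k : ℕ) (hk : k + 1 < n),
      π' = π * Equiv.swap (⟨k, Nat.lt_of_succ_lt hk⟩ : Fin n) ⟨k + 1, hk⟩ := by
  rw [padPerm_eq_listMatrix, rowMergeStep_listMatrix_iff] at h h'
  obtain ⟨i, hi, rfl⟩ := h
  obtain ⟨j, hj, hij⟩ := h'
  have hτ := eq_or_eq_swap_of_mergedIndex hn (Nat.le_of_lt_succ hj) (Nat.le_of_lt_succ hi)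
    (π⁻¹ * π') (by
      intro a
      have hlt : mergedIndex j (a + 1) < n + 1 := by
        unfold mergedIndex; split_ifs <;> omega
      rw [← mergeRows_padEntry_ne_zero_iff π]
      have := listMatrix_inj hij hlt (show (π' a : ℕ) + 1 < n + 2 by omega)
      have e : π ((π⁻¹ * π') a) = π' a := by simp
      rw [e, this, mergeRows_padEntry_ne_zero_iff])
  rcases hτ with h1 | ⟨k, hk, h1⟩
  · left
    rw [inv_mul_eq_one] at h1
    exact h1.symm
  · right
    exact ⟨k, hk, by rw [← h1]; simp⟩

theorem mergeRows_padEntry_mul_swap {n : ℕ} (π : Equiv.Perm (Fin n)) {k : ℕ} (hk : k + 1 < n) :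
    mergeRows (k + 1)
        (padEntry (π * Equiv.swap (⟨k, Nat.lt_of_succ_lt hk⟩ : Fin n) ⟨k + 1, hk⟩)) =
      mergeRows (k + 1) (padEntry π) := by
  set x : Fin n := ⟨k, Nat.lt_of_succ_lt hk⟩
  set y : Fin n := ⟨k + 1, hk⟩
  have h1 (c : ℕ) : padEntry (π * Equiv.swap x y) (k + 1) c = padEntry π (k + 1 + 1) c := by
    have e1 := padEntry_succ (π * Equiv.swap x y) x c
    have e2 := padEntry_succ π y c
    rw [Equiv.Perm.mul_apply, Equiv.swap_apply_left] at e1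
    exact e1.trans e2.symm
  have h2 (c : ℕ) : padEntry (π * Equiv.swap x y) (k + 1 + 1) c = padEntry π (k + 1) c := by
    have e1 := padEntry_succ (π * Equiv.swap x y) y c
    have e2 := padEntry_succ π x c
    rw [Equiv.Perm.mul_apply, Equiv.swap_apply_right] at e1
    exact e1.trans e2.symm
  have h3 (r c : ℕ) (hr1 : r ≠ k + 1) (hr2 : r ≠ k + 1 + 1) :
      padEntry (π * Equiv.swap x y) r c = padEntry π r c := by
    by_cases hr : ∃ a : Fin n, r = a + 1
    · obtain ⟨a, rfl⟩ := hr
      rw [padEntry_succ, padEntry_succ, Equiv.Perm.mul_apply, Equiv.swap_apply_of_ne_of_ne]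
      · rintro rfl; exact hr1 rfl
      · rintro rfl; exact hr2 rfl
    · unfold padEntry
      rw [if_neg, if_neg]
      · rintro ⟨a, b, h, -⟩; exact hr ⟨a, h⟩
      · rintro ⟨a, b, h, -⟩; exact hr ⟨a, h⟩
  funext r c
  unfold mergeRows
  split_ifs with hlt heq
  · exact h3 r c (by omega) (by omega)
  · rw [h1, h2, add_comm]
  · exact h3 (r + 1) c (by omega) (by omega)

theorem rowMergeStep_length {A B : List (List ℕ)} (h : RowMergeStep A B) :
    A.length + 1 = B.length := by
  obtain ⟨u, v, r, s, rfl, rfl⟩ := h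
  simp only [List.length_append, List.length_cons]
  omega

theorem not_rowMergeStep_and_transpose {n : ℕ} {π π' : Equiv.Perm (Fin n)}
    {C : List (List ℕ)} (h : RowMergeStep C (padPerm n π))
    (h' : RowMergeStep C.transpose (padPerm n π').transpose) : False := by
  rw [padPerm_eq_listMatrix, rowMergeStep_listMatrix_iff] at h
  obtain ⟨i, -, rfl⟩ := h
  have := rowMergeStep_length h'
  rw [transpose_listMatrix (by omega), transpose_padPerm, padPerm_eq_listMatrix,
    listMatrix_length, listMatrix_length] at this
  omega

/-- For distinct permutations `π ≠ π'` of `[n]`, there is a matrix obtainable from each of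
the padded permutation matrices `M̂_π` and `M̂_{π'}` by a single row-merge or column-merge
if and only if `π' = σᵢ ∘ π` or `π' = π ∘ σᵢ` for some adjacent transposition
`σᵢ = (i, i+1)`.  Equivalently, the dual graph of the top-dimensional cells of `Multₙ(Q)` is
the overlay of the left and right Cayley graphs of `Symₙ` w.r.t. adjacent transpositions. -/
theorem dual_graph_adjacency (n : ℕ) (hn : 0 < n) (π π' : Equiv.Perm (Fin n))
    (hne : π ≠ π') :
    (∃ C : List (List ℕ), RectStep C (padPerm n π) ∧ RectStep C (padPerm n π')) ↔
    (∃ (i : ℕ) (h : i + 1 < n),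
      π' = Equiv.swap (⟨i, Nat.lt_of_succ_lt h⟩ : Fin n) ⟨i + 1, h⟩ * π ∨
      π' = π * Equiv.swap (⟨i, Nat.lt_of_succ_lt h⟩ : Fin n) ⟨i + 1, h⟩) := by
  constructor
  · rintro ⟨C, h | h, h' | h'⟩
    · rcases eq_or_eq_mul_swap_of_rowMergeStep hn h h' with e | ⟨k, hk, e⟩
      · exact absurd e.symm hne
      · exact ⟨k, hk, Or.inr e⟩
    · exact (not_rowMergeStep_and_transpose h h').elim
    · exact (not_rowMergeStep_and_transpose h' h).elim
    · rw [transpose_padPerm] at h h'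
      rcases eq_or_eq_mul_swap_of_rowMergeStep hn h h' with e | ⟨k, hk, e⟩
      · exact absurd (inv_injective e).symm hne
      · refine ⟨k, hk, Or.inl (inv_injective ?_)⟩
        rw [e, mul_inv_rev, Equiv.swap_inv]
  · rintro ⟨k, hk, rfl | rfl⟩
    · refine ⟨(listMatrix (n + 1) (n + 2) (mergeRows (k + 1) (padEntry π⁻¹))).transpose,
        Or.inr ?_, Or.inr ?_⟩
      all_goals
        rw [transpose_listMatrix (by omega), transpose_listMatrix (by omega), transpose_padPerm,
          padPerm_eq_listMatrix, rowMergeStep_listMatrix_iff]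
        refine ⟨k + 1, by omega, ?_⟩
      · rfl
      · rw [mul_inv_rev, Equiv.swap_inv, mergeRows_padEntry_mul_swap]
    · refine ⟨listMatrix (n + 1) (n + 2) (mergeRows (k + 1) (padEntry π)), Or.inl ?_, Or.inl ?_⟩
      all_goals
        rw [padPerm_eq_listMatrix, rowMergeStep_listMatrix_iff]
        refine ⟨k + 1, by omega, ?_⟩
      · rfl
      · rw [mergeRows_padEntry_mul_swap]
end

section
/- Let n be a positive integer, let Q = [x_ℓ, x_r] × [y_b, y_t] ⊂ ℂ be a closed axis-parallel rectangle with x_ℓ < x_r and y_b < y_t, and let a = (a_{ij}) be a rectangular composition of n of shape (h+2)×(k+2), with rows indexed by x_ℓ, 1, …, h, x_r and columns indexed by y_b, 1, …, k, y_t. Then the map which sends a pair of tuples (x_1, …, x_h) with x_ℓ < x_1 < ⋯ < x_h < x_r and (y_1, …, y_k) with y_b < y_1 < ⋯ < y_k < y_t to the multiset over ℂ containing the point x_i + y_j·i with multiplicity a_{ij} (for all row indices i and column indices j, including the boundary values x_ℓ, x_r, y_b, y_t) is a bijection from the product of the two open order simplices onto the set of multisets z of cardinality n supported in Q whose multiplicity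 matrix is a. In particular, the multiplicity-matrix map from multisets of cardinality n in Q to rectangular compositions of n is surjective, and each fiber is a product of two open simplices. -/
attribute [local instance] Classical.propDecidable

/-- Extend a tuple `t : Fin h → ℝ` of interior points to a tuple indexed by `Fin (h+2)` by
placing the endpoint `xl` first and the endpoint `xr` last. -/
def extendPts (h : ℕ) (xl xr : ℝ) (t : Fin h → ℝ) : Fin (h + 2) → ℝ := fun i =>
  if h0 : (i : ℕ) = 0 then xl
  else if h1 : (i : ℕ) = h + 1 then xr
  else t ⟨(i : ℕ) - 1, by have := i.isLt; omega⟩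

/-- The multiset of the points `x i + y j * I`, each with multiplicity `a i j`. -/
def gridMultiset {m l : ℕ} (a : Matrix (Fin m) (Fin l) ℕ) (x : Fin m → ℝ) (y : Fin l → ℝ) :
    Multiset ℂ :=
  ∑ i, ∑ j, Multiset.replicate (a i j) (⟨x i, y j⟩ : ℂ)

theorem mem_gridMultiset {m l : ℕ} {a : Matrix (Fin m) (Fin l) ℕ} {x : Fin m → ℝ}
    {y : Fin l → ℝ} {w : ℂ} :
    w ∈ gridMultiset a x y ↔ ∃ i j, a i j ≠ 0 ∧ w = ⟨x i, y j⟩ := by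
  simp [gridMultiset, Multiset.mem_sum, Multiset.mem_replicate]

theorem card_gridMultiset {m l : ℕ} (a : Matrix (Fin m) (Fin l) ℕ) (x : Fin m → ℝ)
    (y : Fin l → ℝ) : Multiset.card (gridMultiset a x y) = ∑ i, ∑ j, a i j := by
  simp [gridMultiset, Multiset.card_sum]

theorem count_gridMultiset {m l : ℕ} (a : Matrix (Fin m) (Fin l) ℕ) {x : Fin m → ℝ}
    {y : Fin l → ℝ} (hx : Function.Injective x) (hy : Function.Injective y)
    (i : Fin m) (j : Fin l) :
    Multiset.count (⟨x i, y j⟩ : ℂ) (gridMultiset a x y) = a i j := by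
  rw [gridMultiset, Multiset.count_sum', Finset.sum_eq_single i]
  · rw [Multiset.count_sum', Finset.sum_eq_single j]
    · simp
    · intro j' _ hj
      simp [Multiset.count_replicate, hy.eq_iff, hj]
    · simp
  · intro i' _ hi
    simp [Multiset.count_sum', Multiset.count_replicate, hx.eq_iff, hi]
  · simp

/-- A multiset supported on a grid is determined by its multiplicities on the grid. -/
theorem gridMultiset_eq_of_count {m l : ℕ} {a : Matrix (Fin m) (Fin l) ℕ} {x : Fin m → ℝ}
    {y : Fin l → ℝ} (hx : Function.Injective x) (hy : Function.Injective y) {z : Multiset ℂ}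
    (hz : ∀ i j, Multiset.count (⟨x i, y j⟩ : ℂ) z = a i j)
    (hsupp : ∀ w ∈ z, ∃ i j, w = ⟨x i, y j⟩) : gridMultiset a x y = z := by
  ext w
  by_cases hw : ∃ i j, w = (⟨x i, y j⟩ : ℂ)
  · obtain ⟨i, j, rfl⟩ := hw
    rw [count_gridMultiset a hx hy, hz]
  · rw [Multiset.count_eq_zero_of_notMem, Multiset.count_eq_zero_of_notMem]
    · exact fun h => hw (hsupp w h)
    · intro h
      obtain ⟨i, j, -, h⟩ := mem_gridMultiset.1 h
      exact hw ⟨i, j, h⟩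

theorem extendPts_castSucc_succ (h : ℕ) (xl xr : ℝ) (t : Fin h → ℝ) (i : Fin h) :
    extendPts h xl xr t i.succ.castSucc = t i := by
  have := i.isLt
  simp [extendPts, this.ne]

theorem extendPts_cases {h : ℕ} (xl xr : ℝ) (t : Fin h → ℝ) (i : Fin (h + 2)) :
    extendPts h xl xr t i = xl ∨ extendPts h xl xr t i = xr ∨
      ∃ i', extendPts h xl xr t i = t i' := by
  unfold extendPts
  split_ifs
  · exact .inl rfl
  · exact .inr (.inl rfl)
  · exact .inr (.inr ⟨_, rfl⟩)

theorem extendPts_mem_Icc {h : ℕ} {xl xr : ℝ} (hx : xl < xr) {t : Fin h → ℝ}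
    (ht : ∀ i, t i ∈ Set.Ioo xl xr) (i : Fin (h + 2)) :
    extendPts h xl xr t i ∈ Set.Icc xl xr := by
  rcases extendPts_cases xl xr t i with e | e | ⟨i', e⟩ <;> rw [e]
  · exact Set.left_mem_Icc.2 hx.le
  · exact Set.right_mem_Icc.2 hx.le
  · exact Set.Ioo_subset_Icc_self (ht i')

theorem extendPts_strictMono {h : ℕ} {xl xr : ℝ} (hx : xl < xr) {t : Fin h → ℝ}
    (hmono : StrictMono t) (ht : ∀ i, t i ∈ Set.Ioo xl xr) :
    StrictMono (extendPts h xl xr t) := by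
  intro i j hij
  have hij' : (i : ℕ) < j := hij
  have := j.isLt
  unfold extendPts
  split_ifs
  · omega
  · exact hx
  · exact (ht _).1
  · omega
  · omega
  · omega
  · omega
  · exact (ht _).2
  · refine hmono (Fin.mk_lt_mk.2 ?_)
    omega

/-- If every internal index is hit by `f`, the interior points are the values of
`extendPts` along `f` lying in the open interval. -/
theorem range_eq_extendPts_inter_Ioo {h : ℕ} {xl xr : ℝ} {t : Fin h → ℝ}
    (ht : ∀ i, t i ∈ Set.Ioo xl xr) {S : Set (Fin (h + 2))}
    (hS : ∀ i : Fin h, i.succ.castSucc ∈ S) :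
    Set.range t = extendPts h xl xr t '' S ∩ Set.Ioo xl xr := by
  ext r
  constructor
  · rintro ⟨i, rfl⟩
    exact ⟨⟨_, hS i, extendPts_castSucc_succ h xl xr t i⟩, ht i⟩
  · rintro ⟨⟨i, -, rfl⟩, hi⟩
    rcases extendPts_cases xl xr t i with e | e | ⟨i', e⟩
    · exact absurd hi.1 (by simp [e])
    · exact absurd hi.2 (by simp [e])
    · exact ⟨i', e.symm⟩

/-- The interior points are determined by the values of `extendPts` on a set of indices
containing all internal ones. -/
theorem eq_of_extendPts_image_eq {h : ℕ} {xl xr : ℝ} {t t' : Fin h → ℝ}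
    (hmono : StrictMono t) (hmono' : StrictMono t') (ht : ∀ i, t i ∈ Set.Ioo xl xr)
    (ht' : ∀ i, t' i ∈ Set.Ioo xl xr) {S : Set (Fin (h + 2))}
    (hS : ∀ i : Fin h, i.succ.castSucc ∈ S)
    (himage : extendPts h xl xr t '' S = extendPts h xl xr t' '' S) : t = t' := by
  apply (StrictMono.range_inj hmono hmono').1
  rw [range_eq_extendPts_inter_Ioo ht hS, range_eq_extendPts_inter_Ioo ht' hS, himage]

theorem image_re_gridMultiset {m l : ℕ} (a : Matrix (Fin m) (Fin l) ℕ) (x : Fin m → ℝ)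
    (y : Fin l → ℝ) :
    x '' {i | ∃ j, a i j ≠ 0} = Complex.re '' {w | w ∈ gridMultiset a x y} := by
  ext r
  constructor
  · rintro ⟨i, ⟨j, hij⟩, rfl⟩
    exact ⟨⟨x i, y j⟩, mem_gridMultiset.2 ⟨i, j, hij, rfl⟩, rfl⟩
  · rintro ⟨w, hw, rfl⟩
    obtain ⟨i, j, hij, rfl⟩ := mem_gridMultiset.1 hw
    exact ⟨i, ⟨j, hij⟩, rfl⟩

theorem image_im_gridMultiset {m l : ℕ} (a : Matrix (Fin m) (Fin l) ℕ) (x : Fin m → ℝ)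
    (y : Fin l → ℝ) :
    y '' {j | ∃ i, a i j ≠ 0} = Complex.im '' {w | w ∈ gridMultiset a x y} := by
  ext r
  constructor
  · rintro ⟨j, ⟨i, hij⟩, rfl⟩
    exact ⟨⟨x i, y j⟩, mem_gridMultiset.2 ⟨i, j, hij, rfl⟩, rfl⟩
  · rintro ⟨w, hw, rfl⟩
    obtain ⟨i, j, hij, rfl⟩ := mem_gridMultiset.1 hw
    exact ⟨j, ⟨i, hij⟩, rfl⟩

theorem exists_strictMono_mem_Ioo (h : ℕ) {xl xr : ℝ} (hx : xl < xr) :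
    ∃ t : Fin h → ℝ, StrictMono t ∧ ∀ i, t i ∈ Set.Ioo xl xr := by
  obtain ⟨s, hs, hcard⟩ := (Set.Ioo_infinite hx).exists_subset_card_eq h
  exact ⟨s.orderEmbOfFin hcard, (s.orderEmbOfFin hcard).strictMono,
    fun i => hs (s.orderEmbOfFin_mem hcard i)⟩

/-- Let `a` be a rectangular composition of `n` of shape `(h+2) × (k+2)`.  The map sending
tuples `xl < x₁ < ⋯ < x_h < xr` and `yb < y₁ < ⋯ < y_k < yt` to the multiset over `ℂ`
containing `x_i + y_j i` with multiplicity `a i j` is a bijection from the product of the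
two open order simplices onto the set of multisets of cardinality `n` supported in the
rectangle `Q = [xl, xr] × [yb, yt]` whose multiplicity matrix is `a`.  In particular that
set is nonempty, so the multiplicity-matrix map is surjective. -/
theorem rectComp_fiber_bijOn (n h k : ℕ) (hn : 0 < n) (xl xr yb yt : ℝ)
    (hx : xl < xr) (hy : yb < yt) (a : Matrix (Fin (h + 2)) (Fin (k + 2)) ℕ)
    (hrow : ∀ i : Fin (h + 2), 0 < (i : ℕ) → (i : ℕ) < h + 1 → 0 < ∑ j, a i j)
    (hcol : ∀ j : Fin (k + 2), 0 < (j : ℕ) → (j : ℕ) < k + 1 → 0 < ∑ i, a i j)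
    (hsum : ∑ i, ∑ j, a i j = n) :
    Set.BijOn
      (fun p : (Fin h → ℝ) × (Fin k → ℝ) =>
        ∑ i : Fin (h + 2), ∑ j : Fin (k + 2),
          Multiset.replicate (a i j)
            ((⟨extendPts h xl xr p.1 i, extendPts k yb yt p.2 j⟩ : ℂ)))
      ({t : Fin h → ℝ | StrictMono t ∧ ∀ i, t i ∈ Set.Ioo xl xr} ×ˢ
        {s : Fin k → ℝ | StrictMono s ∧ ∀ j, s j ∈ Set.Ioo yb yt})
      {z : Multiset ℂ | Multiset.card z = n ∧
        (∀ w ∈ z, w.re ∈ Set.Icc xl xr ∧ w.im ∈ Set.Icc yb yt) ∧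
        ∃ (t : Fin h → ℝ) (s : Fin k → ℝ), StrictMono t ∧ StrictMono s ∧
          (∀ i, t i ∈ Set.Ioo xl xr) ∧ (∀ j, s j ∈ Set.Ioo yb yt) ∧
          (∀ (i : Fin (h + 2)) (j : Fin (k + 2)),
            Multiset.count ((⟨extendPts h xl xr t i, extendPts k yb yt s j⟩ : ℂ)) z = a i j) ∧
          ∀ w ∈ z, ∃ (i : Fin (h + 2)) (j : Fin (k + 2)),
            w = (⟨extendPts h xl xr t i, extendPts k yb yt s j⟩ : ℂ)} ∧
    {z : Multiset ℂ | Multiset.card z = n ∧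
        (∀ w ∈ z, w.re ∈ Set.Icc xl xr ∧ w.im ∈ Set.Icc yb yt) ∧
        ∃ (t : Fin h → ℝ) (s : Fin k → ℝ), StrictMono t ∧ StrictMono s ∧
          (∀ i, t i ∈ Set.Ioo xl xr) ∧ (∀ j, s j ∈ Set.Ioo yb yt) ∧
          (∀ (i : Fin (h + 2)) (j : Fin (k + 2)),
            Multiset.count ((⟨extendPts h xl xr t i, extendPts k yb yt s j⟩ : ℂ)) z = a i j) ∧
          ∀ w ∈ z, ∃ (i : Fin (h + 2)) (j : Fin (k + 2)),
            w = (⟨extendPts h xl xr t i, extendPts k yb yt s j⟩ : ℂ)}.Nonempty := by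
  have hS : ∀ i : Fin h, i.succ.castSucc ∈ {i | ∃ j, a i j ≠ 0} := fun i => by
    obtain ⟨j, -, hj⟩ := Finset.exists_ne_zero_of_sum_ne_zero
      (hrow i.succ.castSucc (by simp) (by simp)).ne'
    exact ⟨j, hj⟩
  have hT : ∀ j : Fin k, j.succ.castSucc ∈ {j | ∃ i, a i j ≠ 0} := fun j => by
    obtain ⟨i, -, hi⟩ := Finset.exists_ne_zero_of_sum_ne_zero
      (hcol j.succ.castSucc (by simp) (by simp)).ne'
    exact ⟨i, hi⟩
  obtain ⟨t₀, ht₀⟩ := exists_strictMono_mem_Ioo h hx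
  obtain ⟨s₀, hs₀⟩ := exists_strictMono_mem_Ioo k hy
  refine (and_iff_left_of_imp fun hb => ⟨_, hb.mapsTo (Set.mk_mem_prod ht₀ hs₀)⟩).2 ?_
  change Set.BijOn (fun p : (Fin h → ℝ) × (Fin k → ℝ) =>
    gridMultiset a (extendPts h xl xr p.1) (extendPts k yb yt p.2)) _ _
  refine ⟨?_, ?_, ?_⟩
  · rintro ⟨t, s⟩ ⟨⟨ht, ht'⟩, hs, hs'⟩
    refine ⟨(card_gridMultiset _ _ _).trans hsum, fun w hw => ?_, t, s, ht, hs, ht', hs',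
      count_gridMultiset a (extendPts_strictMono hx ht ht').injective
        (extendPts_strictMono hy hs hs').injective, fun w hw => ?_⟩
    · obtain ⟨i, j, -, rfl⟩ := mem_gridMultiset.1 hw
      exact ⟨extendPts_mem_Icc hx ht' i, extendPts_mem_Icc hy hs' j⟩
    · obtain ⟨i, j, -, hw⟩ := mem_gridMultiset.1 hw
      exact ⟨i, j, hw⟩
  · rintro ⟨t, s⟩ ⟨⟨ht, ht'⟩, hs, hs'⟩ ⟨u, v⟩ ⟨⟨hu, hu'⟩, hv, hv'⟩ heq
    dsimp only at heq ht ht' hs hs' hu hu' hv hv'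
    refine Prod.ext (eq_of_extendPts_image_eq ht hu ht' hu' hS ?_)
      (eq_of_extendPts_image_eq hs hv hs' hv' hT ?_)
    · rw [image_re_gridMultiset a _ (extendPts k yb yt s), heq, ← image_re_gridMultiset]
    · rw [image_im_gridMultiset a (extendPts h xl xr t), heq, ← image_im_gridMultiset]
  · rintro z ⟨-, -, t, s, ht, hs, ht', hs', hcount, hsupp⟩
    exact ⟨(t, s), ⟨⟨ht, ht'⟩, hs, hs'⟩,
      gridMultiset_eq_of_count (extendPts_strictMono hx ht ht').injective
        (extendPts_strictMono hy hs hs').injective hcount hsupp⟩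
end

section
/- Let n be a positive integer and let x_1 < x_2 < ⋯ < x_n and y_1 < y_2 < ⋯ < y_n be real numbers. Then the number of multisets z of cardinality n over ℂ such that the multiset of real parts of z equals {x_1, …, x_n} and the multiset of imaginary parts of z equals {y_1, …, y_n} is exactly n!; explicitly, these multisets are precisely the sets {x_1 + y_{π(1)}·i, …, x_n + y_{π(n)}·i} for permutations π of [n], and distinct permutations give distinct multisets. -/
open scoped List in
/-- A multiset whose image under `f` is listed by `x` can itself be listed compatibly with `x`. -/
theorem Multiset.exists_ofFn_of_map_eq_ofFn {α β : Type*} {n : ℕ} (f : α → β) {z : Multiset α}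
    {x : Fin n → β} (h : z.map f = ↑(List.ofFn x)) :
    ∃ w : Fin n → α, z = ↑(List.ofFn w) ∧ ∀ i, f (w i) = x i := by
  induction z using Quotient.inductionOn with
  | _ l =>
    obtain ⟨l', hl', hperm⟩ :
        Relation.Comp (· = List.map f ·) (· ~ ·) (List.ofFn x) l := by
      rw [List.eq_map_comp_perm]
      exact (Multiset.coe_eq_coe.mp h).symm
    have hlen : l'.length = n := by simpa using (congrArg List.length hl').symm
    subst hlen
    refine ⟨l'.get, ?_, fun i => ?_⟩
    · simpa using hperm.symm
    · have := congrArg (fun m => m[i.val]?) hl'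
      simpa using this.symm

/-- If two families over `Fin n` have the same multiset of values and one of them is injective,
they differ by a permutation of the indices. -/
theorem exists_perm_of_coe_ofFn_eq {α : Type*} {n : ℕ} {v y : Fin n → α}
    (hy : Function.Injective y) (h : (↑(List.ofFn v) : Multiset α) = ↑(List.ofFn y)) :
    ∃ π : Equiv.Perm (Fin n), ∀ i, v i = y (π i) := by
  have hp := Multiset.coe_eq_coe.mp h
  have hv : Function.Injective v := List.nodup_ofFn.mp (hp.nodup_iff.mpr (List.nodup_ofFn.mpr hy))
  have hmem : ∀ i, ∃ j, y j = v i := fun i => by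
    simpa [List.mem_ofFn] using hp.mem_iff.mp (show v i ∈ List.ofFn v by simp [List.mem_ofFn])
  choose π hπ using hmem
  have hinj : Function.Injective π := fun i j hij => hv (by rw [← hπ i, ← hπ j, hij])
  exact ⟨Equiv.ofBijective π (Finite.injective_iff_bijective.mp hinj), fun i => (hπ i).symm⟩

/-- Given `x₁ < ⋯ < xₙ` and `y₁ < ⋯ < yₙ`, the multisets `z` of cardinality `n` over `ℂ`
with real parts `{x₁, …, xₙ}` and imaginary parts `{y₁, …, yₙ}` are exactly the multisets
`{x₁ + y_{π(1)} i, …, xₙ + y_{π(n)} i}` for permutations `π`; distinct permutations give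
distinct multisets, and there are exactly `n!` such multisets. -/
theorem fiber_of_distinct_parts (n : ℕ) (hn : 0 < n) (x y : Fin n → ℝ)
    (hx : StrictMono x) (hy : StrictMono y) :
    {z : Multiset ℂ | Multiset.map Complex.re z = ↑(List.ofFn x) ∧
        Multiset.map Complex.im z = ↑(List.ofFn y)} =
      Set.range (fun π : Equiv.Perm (Fin n) =>
        ((List.ofFn (fun i => ((⟨x i, y (π i)⟩ : ℂ)))) : Multiset ℂ)) ∧
    Function.Injective (fun π : Equiv.Perm (Fin n) =>
      ((List.ofFn (fun i => ((⟨x i, y (π i)⟩ : ℂ)))) : Multiset ℂ)) ∧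
    {z : Multiset ℂ | Multiset.map Complex.re z = ↑(List.ofFn x) ∧
        Multiset.map Complex.im z = ↑(List.ofFn y)}.ncard = n.factorial := by
  have hinj : Function.Injective (fun π : Equiv.Perm (Fin n) =>
      ((List.ofFn (fun i => ((⟨x i, y (π i)⟩ : ℂ)))) : Multiset ℂ)) := by
    intro π σ h
    ext1 i
    have hi : (⟨x i, y (π i)⟩ : ℂ) ∈ List.ofFn (fun i => (⟨x i, y (σ i)⟩ : ℂ)) :=
      (Multiset.coe_eq_coe.mp h).mem_iff.mp (List.mem_ofFn.mpr ⟨i, rfl⟩)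
    obtain ⟨j, hj⟩ := List.mem_ofFn.mp hi
    obtain rfl : j = i := hx.injective (congrArg Complex.re hj)
    exact (hy.injective (congrArg Complex.im hj)).symm
  have hset : {z : Multiset ℂ | Multiset.map Complex.re z = ↑(List.ofFn x) ∧
        Multiset.map Complex.im z = ↑(List.ofFn y)} =
      Set.range (fun π : Equiv.Perm (Fin n) =>
        ((List.ofFn (fun i => ((⟨x i, y (π i)⟩ : ℂ)))) : Multiset ℂ)) := by
    ext z
    constructor
    · rintro ⟨hre, him⟩
      obtain ⟨w, rfl, hw⟩ := Multiset.exists_ofFn_of_map_eq_ofFn Complex.re hre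
      rw [Multiset.map_coe, List.map_ofFn] at him
      obtain ⟨π, hπ⟩ := exists_perm_of_coe_ofFn_eq hy.injective him
      refine ⟨π, ?_⟩
      have : (fun i => (⟨x i, y (π i)⟩ : ℂ)) = w :=
        funext fun i => Complex.ext (hw i).symm (hπ i).symm
      simp only [this]
    · rintro ⟨π, rfl⟩
      refine ⟨?_, ?_⟩
      · rw [Multiset.map_coe, List.map_ofFn]
        rfl
      · rw [Multiset.map_coe, List.map_ofFn]
        exact Multiset.coe_eq_coe.mpr (Equiv.Perm.ofFn_comp_perm π y)
  refine ⟨hset, hinj, ?_⟩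
  rw [hset, ← Set.image_univ, Set.ncard_image_of_injective _ hinj, Set.ncard_univ,
    Nat.card_perm, Nat.card_fin]
end

section
/- Let n be a positive integer and let x and y be multisets of real numbers, each of cardinality n. Let u_1 < ⋯ < u_p be the distinct elements of x with multiplicities c_1, …, c_p, and let v_1 < ⋯ < v_q be the distinct elements of y with multiplicities d_1, …, d_q. Then the set of multisets z of cardinality n over ℂ whose multiset of real parts equals x and whose multiset of imaginary parts equals y is in bijection with the set of p×q matrices (m_{ij}) of nonnegative integers whose i-th row sums to c_i for every i and whose j-th column sums to d_j for every j; the bijection sends a matrix (m_{ij}) to the multiset containing u_i + v_j·i with multiplicity m_{ij}. -/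
section SumReplicate

variable {ι κ α β : Type*} [Fintype ι] [Fintype κ]

theorem Multiset.count_sum_replicate_of_injective [DecidableEq α] {w : ι → α}
    (hw : Function.Injective w) (c : ι → ℕ) (i : ι) :
    Multiset.count (w i) (∑ k, Multiset.replicate (c k) (w k)) = c i := by
  classical
  simp [Multiset.count_sum', Multiset.count_replicate, hw.eq_iff]

theorem Multiset.sum_replicate_injective {w : ι → α} (hw : Function.Injective w) :
    Function.Injective fun c : ι → ℕ => ∑ k, Multiset.replicate (c k) (w k) := by
  classical
  intro c d h
  funext i
  rw [← count_sum_replicate_of_injective hw c i, ← count_sum_replicate_of_injective hw d i]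
  exact congrArg _ h

theorem Multiset.sum_replicate_count [DecidableEq α] {w : ι → α}
    (hw : Function.Injective w) {s : Multiset α} (hs : ∀ a ∈ s, a ∈ Set.range w) :
    ∑ k, Multiset.replicate (s.count (w k)) (w k) = s := by
  ext a
  by_cases ha : a ∈ Set.range w
  · obtain ⟨i, rfl⟩ := ha
    exact count_sum_replicate_of_injective hw _ i
  · rw [Multiset.count_eq_zero_of_notMem fun h => ha (hs a h), Multiset.count_sum']
    refine Finset.sum_eq_zero fun k _ => ?_
    rw [Multiset.count_replicate, if_neg fun h => ha ⟨k, h⟩]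

theorem Multiset.mem_range_of_mem_sum_replicate {w : ι → α} {c : ι → ℕ} {a : α}
    (ha : a ∈ ∑ k, Multiset.replicate (c k) (w k)) : a ∈ Set.range w := by
  obtain ⟨k, -, hk⟩ := Multiset.mem_sum.1 ha
  exact ⟨k, (Multiset.eq_of_mem_replicate hk).symm⟩

theorem Multiset.map_sum_sum_replicate (f : α → β) (m : ι → κ → ℕ) (w : ι → κ → α)
    {g : ι → β} (h : ∀ i j, f (w i j) = g i) :
    Multiset.map f (∑ i, ∑ j, Multiset.replicate (m i j) (w i j)) =
      ∑ i, Multiset.replicate (∑ j, m i j) (g i) := by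
  rw [← Multiset.coe_mapAddMonoidHom]
  simp only [map_sum, Multiset.coe_mapAddMonoidHom, Multiset.map_replicate, h]
  exact Finset.sum_congr rfl fun i _ =>
    (map_sum (Multiset.replicateAddMonoidHom (g i)) _ _).symm

end SumReplicate


/-- Let `x` and `y` be multisets of reals of cardinality `n`, with distinct elements
`u₁ < ⋯ < u_p` of multiplicities `c₁, …, c_p` and `v₁ < ⋯ < v_q` of multiplicities
`d₁, …, d_q` respectively.  Then the map sending a `p × q` matrix `(m i j)` of nonnegative
integers to the multiset containing `u_i + v_j i` with multiplicity `m i j` is a bijection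
from the set of matrices with row sums `c` and column sums `d` onto the set of multisets
`z` over `ℂ` with `Re(z) = x` and `Im(z) = y`. -/
theorem fiber_bijOn_matrices (n p q : ℕ) (hn : 0 < n)
    (u : Fin p → ℝ) (v : Fin q → ℝ) (hu : StrictMono u) (hv : StrictMono v)
    (c : Fin p → ℕ) (d : Fin q → ℕ) (hc : ∀ i, 0 < c i) (hd : ∀ j, 0 < d j)
    (hcn : ∑ i, c i = n) (hdn : ∑ j, d j = n) :
    Set.BijOn
      (fun m : Matrix (Fin p) (Fin q) ℕ =>
        ∑ i, ∑ j, Multiset.replicate (m i j) ((⟨u i, v j⟩ : ℂ)))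
      {m : Matrix (Fin p) (Fin q) ℕ |
        (∀ i, ∑ j, m i j = c i) ∧ (∀ j, ∑ i, m i j = d j)}
      {z : Multiset ℂ |
        Multiset.map Complex.re z = ∑ i, Multiset.replicate (c i) (u i) ∧
        Multiset.map Complex.im z = ∑ j, Multiset.replicate (d j) (v j)} := by
  have hre (m : Matrix (Fin p) (Fin q) ℕ) :
      Multiset.map Complex.re (∑ i, ∑ j, Multiset.replicate (m i j) (⟨u i, v j⟩ : ℂ)) =
        ∑ i, Multiset.replicate (∑ j, m i j) (u i) :=
    Multiset.map_sum_sum_replicate _ _ _ fun _ _ => rfl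
  have him (m : Matrix (Fin p) (Fin q) ℕ) :
      Multiset.map Complex.im (∑ i, ∑ j, Multiset.replicate (m i j) (⟨u i, v j⟩ : ℂ)) =
        ∑ j, Multiset.replicate (∑ i, m i j) (v j) := by
    rw [Finset.sum_comm]
    exact Multiset.map_sum_sum_replicate _ (fun j i => m i j) _ fun _ _ => rfl
  have hw : Function.Injective fun k : Fin p × Fin q => (⟨u k.1, v k.2⟩ : ℂ) := by
    rintro ⟨i, j⟩ ⟨i', j'⟩ h
    exact Prod.ext (hu.injective (congrArg Complex.re h)) (hv.injective (congrArg Complex.im h))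
  refine ⟨?_, ?_, ?_⟩
  · rintro m ⟨hrow, hcol⟩
    refine ⟨?_, ?_⟩
    · simp only [hre, hrow]
    · simp only [him, hcol]
  · intro m _ m' _ h
    simp only [← Fintype.sum_prod_type'] at h
    have h' := Multiset.sum_replicate_injective hw
      (a₁ := fun k => m k.1 k.2) (a₂ := fun k => m' k.1 k.2) h
    ext i j
    exact congrFun h' (i, j)
  · rintro z ⟨hx, hy⟩
    classical
    let m : Matrix (Fin p) (Fin q) ℕ := fun i j => z.count ⟨u i, v j⟩
    have hz : ∑ i, ∑ j, Multiset.replicate (m i j) (⟨u i, v j⟩ : ℂ) = z := by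
      rw [← Fintype.sum_prod_type']
      refine Multiset.sum_replicate_count hw fun a ha => ?_
      obtain ⟨i, hi⟩ := Multiset.mem_range_of_mem_sum_replicate
        (hx ▸ Multiset.mem_map_of_mem Complex.re ha)
      obtain ⟨j, hj⟩ := Multiset.mem_range_of_mem_sum_replicate
        (hy ▸ Multiset.mem_map_of_mem Complex.im ha)
      exact ⟨(i, j), Complex.ext hi hj⟩
    refine ⟨m, ⟨?_, ?_⟩, hz⟩
    · refine congrFun (Multiset.sum_replicate_injective hu.injective ?_)
      exact (hre m).symm.trans
        ((congrArg (Multiset.map Complex.re) hz).trans hx)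
    · refine congrFun (Multiset.sum_replicate_injective hv.injective ?_)
      exact (him m).symm.trans
        ((congrArg (Multiset.map Complex.im) hz).trans hy)
end
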